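/- Let d ≥ 1 and C ≥ 1, let a_1, …, a_C ∈ ℝᵈ and b_1, …, b_C ∈ ℝ, and for w ∈ ℝᵈ define the softmax probability p(w)_i = exp(a_i·w + b_i) / Σ_{j=1}^C exp(a_j·w + b_j). Fix z ∈ ℝᵈ and σ ∈ ℝᵈ with σ_k ≥ 0, let Σ = diag(σ₁²,…,σ_d²), and let Z̃ be a random vector in ℝᵈ distributed according to the product measure ⊗_{k=1}^d N(z_k, σ_k²). Then E[ KL( p(z) ‖ p(Z̃) ) ] ≤ Σ_{i=1}^C p(z)_i · log( p(z)_i · Σ_{j=1}^C exp( (a_j − a_i)·z + (b_j − b_i) + (1/2)(a_j − a_i)Σ(a_j − a_i)ᵀ ) ), where for u ∈ ℝᵈ we write uΣuᵀ = Σ_{k=1}^d u_k² σ_k². -/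

import Mathlib

open Real BigOperators Finset MeasureTheory ProbabilityTheory

/-- The softmax prediction probability `p(w)_i = exp(a_i·w + b_i) / ∑_j exp(a_j·w + b_j)`. -/
noncomputable def softmax {d C : ℕ} (a : Fin C → Fin d → ℝ) (b : Fin C → ℝ)
    (w : Fin d → ℝ) (i : Fin C) : ℝ :=
  Real.exp ((∑ k, a i k * w k) + b i) / ∑ j, Real.exp ((∑ k, a j k * w k) + b j)

/-- A random variable bounded below by one has integrable logarithm. -/
lemma integrable_log_of_one_le {Ω : Type*} [MeasurableSpace Ω] {μ : Measure Ω} {f : Ω → ℝ}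
    (hf : Integrable f μ) (h_one : ∀ x, 1 ≤ f x) : Integrable (fun x ↦ Real.log (f x)) μ := by
  refine hf.mono' hf.aemeasurable.log.aestronglyMeasurable (ae_of_all _ fun x ↦ ?_)
  rw [Real.norm_of_nonneg (Real.log_nonneg (h_one x))]
  exact Real.log_le_self (zero_le_one.trans (h_one x))

/-- Jensen's inequality for the logarithm of a random variable bounded below by one. -/
lemma integral_log_le_log_integral {Ω : Type*} [MeasurableSpace Ω] {μ : Measure Ω}
    [IsProbabilityMeasure μ] {f : Ω → ℝ} (hf : Integrable f μ) (h_one : ∀ x, 1 ≤ f x) :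
    ∫ x, Real.log (f x) ∂μ ≤ Real.log (∫ x, f x ∂μ) := by
  have h_mean : 1 ≤ ∫ x, f x ∂μ := by
    simpa using integral_mono (integrable_const (1 : ℝ)) hf h_one
  have h_pos : 0 < ∫ x, f x ∂μ := zero_lt_one.trans_le h_mean
  have h_tangent (x : Ω) :
      Real.log (f x) ≤ f x / (∫ y, f y ∂μ) + (Real.log (∫ y, f y ∂μ) - 1) := by
    have hx : 0 < f x := zero_lt_one.trans_le (h_one x)
    have h := Real.log_le_sub_one_of_pos (div_pos hx h_pos)
    rw [Real.log_div hx.ne' h_pos.ne'] at h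
    linarith
  calc ∫ x, Real.log (f x) ∂μ
      ≤ ∫ x, (f x / (∫ y, f y ∂μ) + (Real.log (∫ y, f y ∂μ) - 1)) ∂μ :=
        integral_mono (integrable_log_of_one_le hf h_one)
          ((hf.div_const _).add (integrable_const _)) h_tangent
    _ = Real.log (∫ x, f x ∂μ) := by
        rw [integral_add (hf.div_const _) (integrable_const _), integral_div, div_self h_pos.ne']
        simp

lemma exp_linear_add_eq_prod {d : ℕ} (u w : Fin d → ℝ) (c : ℝ) :
    Real.exp ((∑ k, u k * w k) + c) = (∏ k, Real.exp (u k * w k)) * Real.exp c := by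
  rw [Real.exp_add, Real.exp_sum]

lemma integrable_exp_linear_pi_gaussianReal {d : ℕ} (z : Fin d → ℝ) (v : Fin d → NNReal)
    (u : Fin d → ℝ) (c : ℝ) :
    Integrable (fun w : Fin d → ℝ ↦ Real.exp ((∑ k, u k * w k) + c))
      (Measure.pi fun k ↦ gaussianReal (z k) (v k)) := by
  simp_rw [exp_linear_add_eq_prod]
  exact (Integrable.fintype_prod (f := fun k x ↦ Real.exp (u k * x))
    fun k ↦ integrable_exp_mul_gaussianReal (u k)).mul_const _

/-- The moment generating function of a product of real Gaussian measures. -/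
lemma integral_exp_linear_pi_gaussianReal {d : ℕ} (z : Fin d → ℝ) (v : Fin d → NNReal)
    (u : Fin d → ℝ) (c : ℝ) :
    ∫ w : Fin d → ℝ, Real.exp ((∑ k, u k * w k) + c)
        ∂(Measure.pi fun k ↦ gaussianReal (z k) (v k))
      = Real.exp ((∑ k, u k * z k) + c + (1 / 2) * ∑ k, u k ^ 2 * (v k : ℝ)) := by
  have h_mgf (k : Fin d) : ∫ x, Real.exp (u k * x) ∂gaussianReal (z k) (v k)
      = Real.exp (u k * z k + (1 / 2) * (u k ^ 2 * v k)) := by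
    have h := congrFun (mgf_id_gaussianReal (μ := z k) (v := v k)) (u k)
    simp only [mgf, id] at h
    rw [h]
    ring_nf
  simp_rw [exp_linear_add_eq_prod]
  rw [integral_mul_const, integral_fintype_prod_eq_prod (f := fun k x ↦ Real.exp (u k * x))]
  simp_rw [h_mgf]
  rw [← Real.exp_sum, ← Real.exp_add, sum_add_distrib, ← mul_sum]
  ring_nf

lemma softmax_pos {d C : ℕ} (a : Fin C → Fin d → ℝ) (b : Fin C → ℝ) (w : Fin d → ℝ)
    (i : Fin C) : 0 < softmax a b w i :=
  div_pos (Real.exp_pos _) (sum_pos (fun _ _ ↦ Real.exp_pos _) ⟨i, mem_univ i⟩)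

lemma inv_softmax {d C : ℕ} (a : Fin C → Fin d → ℝ) (b : Fin C → ℝ) (w : Fin d → ℝ)
    (i : Fin C) :
    (softmax a b w i)⁻¹ = ∑ j, Real.exp ((∑ k, (a j k - a i k) * w k) + (b j - b i)) := by
  rw [softmax, inv_div, sum_div]
  refine sum_congr rfl fun j _ ↦ ?_
  rw [← Real.exp_sub]
  simp_rw [sub_mul]
  rw [sum_sub_distrib]
  ring_nf

lemma one_le_inv_softmax {d C : ℕ} (a : Fin C → Fin d → ℝ) (b : Fin C → ℝ) (w : Fin d → ℝ)
    (i : Fin C) : 1 ≤ (softmax a b w i)⁻¹ := by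
  rw [inv_softmax]
  simpa using single_le_sum
    (f := fun j ↦ Real.exp ((∑ k, (a j k - a i k) * w k) + (b j - b i)))
    (fun j _ ↦ (Real.exp_pos _).le) (mem_univ i)

/-- The expected divergence bound for a product of real Gaussian measures with variances `v k`. -/
lemma integral_kl_softmax_le_pi_gaussianReal {d C : ℕ} (a : Fin C → Fin d → ℝ) (b : Fin C → ℝ)
    (z : Fin d → ℝ) (v : Fin d → NNReal) :
    ∫ w : Fin d → ℝ, (∑ i, softmax a b z i * Real.log (softmax a b z i / softmax a b w i))
        ∂(Measure.pi fun k ↦ gaussianReal (z k) (v k))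
      ≤ ∑ i, softmax a b z i *
          Real.log (softmax a b z i *
            ∑ j, Real.exp ((∑ k, (a j k - a i k) * z k) + (b j - b i)
              + (1 / 2) * ∑ k, (a j k - a i k) ^ 2 * (v k : ℝ))) := by
  have h_int (i : Fin C) : Integrable (fun w ↦ (softmax a b w i)⁻¹)
      (Measure.pi fun k ↦ gaussianReal (z k) (v k)) := by
    simp_rw [inv_softmax]
    exact integrable_finsetSum _ fun j _ ↦ integrable_exp_linear_pi_gaussianReal _ _ _ _
  have h_log (i : Fin C) := integrable_log_of_one_le (h_int i) (one_le_inv_softmax a b · i)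
  have h_split (i : Fin C) (w : Fin d → ℝ) :
      Real.log (softmax a b z i / softmax a b w i)
        = Real.log (softmax a b z i) + Real.log (softmax a b w i)⁻¹ := by
    rw [div_eq_mul_inv, Real.log_mul (softmax_pos a b z i).ne'
      (inv_pos.2 (softmax_pos a b w i)).ne']
  simp_rw [h_split]
  rw [integral_finsetSum _ fun i _ ↦ ((integrable_const _).fun_add (h_log i)).const_mul _]
  refine sum_le_sum fun i _ ↦ ?_
  rw [integral_const_mul, integral_add (integrable_const _) (h_log i), integral_const,
    probReal_univ, one_smul, Real.log_mul (softmax_pos a b z i).ne'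
      (sum_pos (fun _ _ ↦ Real.exp_pos _) ⟨i, mem_univ i⟩).ne']
  gcongr
  · exact (softmax_pos a b z i).le
  · refine (integral_log_le_log_integral (h_int i) (one_le_inv_softmax a b · i)).trans_eq ?_
    simp_rw [inv_softmax]
    rw [integral_finsetSum _ fun j _ ↦ integrable_exp_linear_pi_gaussianReal _ _ _ _]
    simp_rw [integral_exp_linear_pi_gaussianReal]

/-- **Intermediate KL bound** (Eq. (23) in the appendix proof of Proposition 2):
if `Z̃ ~ ⊗ₖ N(z k, (σ k)²)` (diagonal covariance `Σ = diag(σ₁², …, σ_d²)`), then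
`E[KL(p(z) ‖ p(Z̃))] ≤ ∑_i p(z)_i · log(p(z)_i · ∑_j exp((a_j − a_i)·z + (b_j − b_i)
  + ½ (a_j − a_i) Σ (a_j − a_i)ᵀ))`. -/
theorem expected_kl_intermediate_bound (d C : ℕ) (hd : 1 ≤ d) (hC : 1 ≤ C)
    (a : Fin C → Fin d → ℝ) (b : Fin C → ℝ)
    (z σ : Fin d → ℝ) (hσ : ∀ k, 0 ≤ σ k) :
    ∫ w : Fin d → ℝ, (∑ i, softmax a b z i * Real.log (softmax a b z i / softmax a b w i))
        ∂(Measure.pi fun k => gaussianReal (z k) ⟨(σ k) ^ 2, sq_nonneg _⟩)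
      ≤ ∑ i, softmax a b z i *
          Real.log (softmax a b z i *
            ∑ j, Real.exp ((∑ k, (a j k - a i k) * z k) + (b j - b i)
              + (1 / 2) * ∑ k, (a j k - a i k) ^ 2 * (σ k) ^ 2)) := by
  exact integral_kl_softmax_le_pi_gaussianReal a b z fun k ↦ ⟨(σ k) ^ 2, sq_nonneg _⟩
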